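/- Let Ψ ∈ Matrix (Fin 2) (Fin 2) ℝ and let c = !![0, 1; -1, 0]. Then trace((c Ψ)²) = 2 ‖dev₂ sym Ψ‖² − trace(Ψ²), where sym Ψ = (Ψ + Ψᵀ)/2, dev₂ X = X − (trace X / 2)·1, and ‖·‖ is the Frobenius norm (‖X‖² = trace(XᵀX)). (Alternator identity stated in Section 4 of the paper.) -/

import Mathlib

open Matrix

/-- The two-dimensional alternator matrix. -/
def altc : Matrix (Fin 2) (Fin 2) ℝ := !![0, 1; -1, 0]

/-- Symmetric part of a 2×2 matrix. -/
noncomputable def symPart (X : Matrix (Fin 2) (Fin 2) ℝ) : Matrix (Fin 2) (Fin 2) ℝ :=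
  (X + Xᵀ) / 2

/-- Two-dimensional deviatoric part. -/
noncomputable def dev2 (X : Matrix (Fin 2) (Fin 2) ℝ) : Matrix (Fin 2) (Fin 2) ℝ :=
  X - (trace X / 2) • (1 : Matrix (Fin 2) (Fin 2) ℝ)

/-- Squared Frobenius norm `‖X‖² = tr(XᵀX)`. -/
def frobSq (X : Matrix (Fin 2) (Fin 2) ℝ) : ℝ := trace (Xᵀ * X)

theorem symPart_eq_smul (X : Matrix (Fin 2) (Fin 2) ℝ) :
    symPart X = (1 / 2 : ℝ) • (X + Xᵀ) := by
  have h : (2 : Matrix (Fin 2) (Fin 2) ℝ)⁻¹ = (1 / 2 : ℝ) • 1 := by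
    apply Matrix.inv_eq_left_inv
    rw [smul_mul_assoc, one_mul]
    ext i j
    fin_cases i <;> fin_cases j <;> simp [Matrix.ofNat_apply]
  rw [symPart, div_eq_mul_inv, h, mul_smul_comm, mul_one]

/-- the alternator identity
`tr((cΨ)²) = 2‖dev₂ sym Ψ‖² − tr(Ψ²)`. -/
theorem alternator_dev_sym_identity (Ψ : Matrix (Fin 2) (Fin 2) ℝ) :
    trace ((altc * Ψ) * (altc * Ψ))
      = 2 * frobSq (dev2 (symPart Ψ)) - trace (Ψ * Ψ) := by
  rw [symPart_eq_smul]
  simp only [frobSq, Matrix.trace_fin_two, Matrix.mul_apply, Fin.sum_univ_two]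
  simp [dev2, altc, Matrix.trace_fin_two, Matrix.mul_apply, Fin.sum_univ_two]
  ring
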